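/- For every n ≥ 3 there exists N_0 = N_0(n) ≥ 1 such that for all real N ≥ N_0 the following holds: if l ∈ {1, …, n−1} and k ∈ D_n satisfies Ω_l(k) ≠ 0 and |k_1|^{2l−1} ≥ N |Ω_l(k)|, then either k_1 + k_2 = 0 and |k_1| ≥ N^{1/(2n)}, or |k_3| ≥ N^{1/(2n)}. -/

import Mathlib

/-- Two integers of comparable size that do not cancel have odd powers that do not nearly cancel. -/
theorem abs_pow_le_abs_odd_pow_add {x y : ℤ} (l : ℕ) (hyx : |y| ≤ |x|) (hxy : x + y ≠ 0) :
    |x| ^ (2 * l) ≤ |x ^ (2 * l + 1) + y ^ (2 * l + 1)| := by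
  wlog hx : 0 ≤ x generalizing x y
  · have h := this (x := -x) (y := -y) (by simpa using hyx) (by omega) (by omega)
    have hodd : Odd (2 * l + 1) := odd_two_mul_add_one l
    rwa [abs_neg, hodd.neg_pow, hodd.neg_pow, ← neg_add, abs_neg] at h
  rw [abs_of_nonneg hx] at hyx ⊢
  obtain ⟨hlo, hhi⟩ := abs_le.mp hyx
  have hx1 : 1 ≤ x := by omega
  have hpow : y ^ (2 * l) ≤ x ^ (2 * l) := by
    rw [pow_mul, pow_mul]
    exact pow_le_pow_left₀ (sq_nonneg y) (sq_le_sq' hlo hhi) l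
  have hnn : 0 ≤ y ^ (2 * l) := (even_two_mul l).pow_nonneg y
  have h1 : 0 ≤ (x - 1) * (x ^ (2 * l) - y ^ (2 * l)) :=
    mul_nonneg (by omega) (by omega)
  have h2 : 0 ≤ (x + y - 1) * y ^ (2 * l) := mul_nonneg (by omega) hnn
  refine le_trans ?_ (le_abs_self _)
  rw [pow_succ, pow_succ]
  linarith

/-- The odd power sum of an integer tuple controls `|k 0| ^ (2 * l)` up to the contribution of the
entries beyond the first two. -/
theorem abs_pow_le_abs_odd_pow_sum_add {m : ℕ} (l : ℕ) (k : Fin (m + 2) → ℤ) {c : ℤ}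
    (h10 : |k 1| ≤ |k 0|) (hne : k 0 + k 1 ≠ 0) (hc : ∀ i : Fin m, |k i.succ.succ| ≤ c) :
    |k 0| ^ (2 * l) ≤ |∑ i, k i ^ (2 * l + 1)| + m * c ^ (2 * l + 1) := by
  have hrest : |∑ i : Fin m, k i.succ.succ ^ (2 * l + 1)| ≤ m * c ^ (2 * l + 1) :=
    calc |∑ i : Fin m, k i.succ.succ ^ (2 * l + 1)|
        ≤ ∑ i : Fin m, |k i.succ.succ ^ (2 * l + 1)| := Finset.abs_sum_le_sum_abs _ _
      _ ≤ ∑ _i : Fin m, c ^ (2 * l + 1) := Finset.sum_le_sum fun i _ ↦ by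
          rw [abs_pow]
          exact pow_le_pow_left₀ (abs_nonneg _) (hc i) _
      _ = m * c ^ (2 * l + 1) := by simp
  have hlead := abs_pow_le_abs_odd_pow_add l h10 hne
  rw [Fin.sum_univ_succ, Fin.sum_univ_succ, Fin.succ_zero_eq_one, ← add_assoc]
  have htri := abs_sub
    (k 0 ^ (2 * l + 1) + k 1 ^ (2 * l + 1) + ∑ i : Fin m, k i.succ.succ ^ (2 * l + 1))
    (∑ i : Fin m, k i.succ.succ ^ (2 * l + 1))
  rw [add_sub_cancel_right] at htri
  linarith


/-- For every `n ≥ 3` there exists `N₀ = N₀(n) ≥ 1` such that for all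
`N ≥ N₀`, if `l ∈ {1,…,n−1}` and `k ∈ D_n` satisfies `Ω_l(k) ≠ 0` and
`|k₁|^{2l−1} ≥ N|Ω_l(k)|`, then either `k₁ + k₂ = 0` and `|k₁| ≥ N^{1/(2n)}`, or
`|k₃| ≥ N^{1/(2n)}`. -/
theorem stmt4 (n : ℕ) (hn : 3 ≤ n) :
    ∃ N₀ : ℝ, 1 ≤ N₀ ∧ ∀ N : ℝ, N₀ ≤ N →
      ∀ l : ℕ, 1 ≤ l → l ≤ n - 1 →
      ∀ k : Fin n → ℤ, (∀ i, k i ≠ 0) → (∑ i, k i = 0) →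
        (∀ i j : Fin n, i ≤ j → |k j| ≤ |k i|) →
        (∑ i, k i ^ (2 * l + 1)) ≠ 0 →
        N * ((|∑ i, k i ^ (2 * l + 1)| : ℝ)) ≤ ((|k ⟨0, by omega⟩| : ℝ)) ^ (2 * l - 1) →
        (k ⟨0, by omega⟩ + k ⟨1, by omega⟩ = 0 ∧
            N ^ ((1 : ℝ) / (2 * (n : ℝ))) ≤ (|k ⟨0, by omega⟩| : ℝ)) ∨
          N ^ ((1 : ℝ) / (2 * (n : ℝ))) ≤ (|k ⟨2, by omega⟩| : ℝ) := by
  have hn0 : (0 : ℝ) < 2 * n := by positivity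
  have hn6 : (6 : ℝ) ≤ 2 * n := by
    have : (3 : ℝ) ≤ n := by exact_mod_cast hn
    linarith
  refine ⟨(2 * n : ℝ) ^ (2 * n), one_le_pow₀ (by linarith), ?_⟩
  intro N hN l hl1 hln k hk0 _ hmono hΩ hres
  set M : ℝ := N ^ ((1 : ℝ) / (2 * (n : ℝ))) with hM
  have hNpos : 0 < N := lt_of_lt_of_le (by positivity) hN
  have hMN : M ^ (2 * n) = N := by
    rw [hM, ← Real.rpow_natCast, ← Real.rpow_mul hNpos.le]
    push_cast
    rw [one_div_mul_cancel hn0.ne', Real.rpow_one]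
  have hM0 : 0 ≤ M := Real.rpow_nonneg hNpos.le _
  have hMn : (2 * n : ℝ) ≤ M :=
    le_of_pow_le_pow_left₀ (n := 2 * n) (by omega) hM0 (by rwa [hMN])
  have hMpow {j : ℕ} (hj : j ≤ 2 * n) : M ^ j ≤ N :=
    hMN ▸ pow_le_pow_right₀ (by linarith) hj
  have hN6 : 6 ≤ N := by
    have := hMpow (j := 1) (by omega)
    rw [pow_one] at this
    linarith
  have hΩ1 : (1 : ℝ) ≤ |∑ i, (k i : ℝ) ^ (2 * l + 1)| := by
    exact_mod_cast Int.one_le_abs hΩ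
  have hA1 : (1 : ℝ) ≤ |(k ⟨0, by omega⟩ : ℝ)| := by
    exact_mod_cast Int.one_le_abs (hk0 _)
  have hNA : N ≤ |(k ⟨0, by omega⟩ : ℝ)| ^ (2 * l - 1) := by nlinarith
  by_cases hs : k ⟨0, by omega⟩ + k ⟨1, by omega⟩ = 0
  · refine Or.inl ⟨hs, le_of_pow_le_pow_left₀ (n := 2 * n) (by omega) (by linarith) ?_⟩
    rw [hMN]
    exact hNA.trans (pow_le_pow_right₀ hA1 (by omega))
  · right
    by_contra! hc
    obtain ⟨m, rfl⟩ : ∃ m, n = m + 2 := ⟨n - 2, by omega⟩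
    have hmain := abs_pow_le_abs_odd_pow_sum_add l k (c := |k ⟨2, by omega⟩|)
      (hmono 0 1 (Fin.zero_le _)) hs
      (fun i ↦ hmono _ _ (Fin.mk_le_of_le_val (by simp)))
    have hmainR : |(k 0 : ℝ)| ^ (2 * l) ≤ |∑ i, (k i : ℝ) ^ (2 * l + 1)| +
        m * |(k ⟨2, by omega⟩ : ℝ)| ^ (2 * l + 1) := by
      exact_mod_cast hmain
    have htail : 2 * (m * |(k ⟨2, by omega⟩ : ℝ)| ^ (2 * l + 1)) ≤ N :=
      calc 2 * (m * |(k ⟨2, by omega⟩ : ℝ)| ^ (2 * l + 1))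
          = (2 * m) * |(k ⟨2, by omega⟩ : ℝ)| ^ (2 * l + 1) := by ring
        _ ≤ M * M ^ (2 * l + 1) := by
            gcongr
            push_cast at hMn
            linarith
        _ = M ^ (2 * l + 2) := by ring
        _ ≤ N := hMpow (by omega)
    have hPQ : |(k 0 : ℝ)| ^ (2 * l - 1) ≤ |(k 0 : ℝ)| ^ (2 * l) :=
      pow_le_pow_right₀ hA1 (by omega)
    change N * _ ≤ |(k 0 : ℝ)| ^ (2 * l - 1) at hres
    change N ≤ |(k 0 : ℝ)| ^ (2 * l - 1) at hNA
    have hΩ6 := mul_le_mul_of_nonneg_right hN6 (abs_nonneg (∑ i, (k i : ℝ) ^ (2 * l + 1)))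
    linarith
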